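/- Let a, b ∈ ℂ with a + b + 1/2 not a nonpositive integer. Then there is an open neighborhood U of 0 in ℂ such that the function g(x) = ₂F₁(a, b; a+b+1/2; x²(x+3)/4) satisfies Heun's differential equation with parameters (t, q; a', b'; c'; d') = (-3, 0; 3a, 3b; 2a+2b; 1/2) at every x ∈ U with x ∉ {0, 1, -3}. -/

import Mathlib

open Complex

/-- `g` satisfies Heun's differential equation with parameters `(t, q; a, b; c; d)`
at the point `x`: `g` is twice complex differentiable at `x` and
`g''(x) + (c/x + d/(x-1) + (a+b-c-d+1)/(x-t)) g'(x) + ((a b x - q)/(x(x-1)(x-t))) g(x) = 0`. -/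
def SatisfiesHeunAt (t q a b c d : ℂ) (g : ℂ → ℂ) (x : ℂ) : Prop :=
  DifferentiableAt ℂ g x ∧ DifferentiableAt ℂ (deriv g) x ∧
    deriv (deriv g) x +
      (c / x + d / (x - 1) + (a + b - c - d + 1) / (x - t)) * deriv g x +
      ((a * b * x - q) / (x * (x - 1) * (x - t))) * g x = 0

theorem powser_deriv (u : ℕ → ℂ) (hu : ∀ z : ℂ, ‖z‖ < 1 → Summable (fun n => u n * z ^ n))
    (z : ℂ) (hz : ‖z‖ < 1) :
    Summable (fun n : ℕ => (((n : ℂ) + 1) * u (n + 1)) * z ^ n) ∧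
    HasDerivAt (fun w => ∑' n, u n * w ^ n)
      (∑' n : ℕ, (((n : ℂ) + 1) * u (n + 1)) * z ^ n) z := by
  obtain ⟨r, hr1, hr2⟩ := exists_between hz
  have hr0 : 0 ≤ r := (norm_nonneg z).trans hr1.le
  have hs : Summable (fun n => ‖u n * (r : ℂ) ^ n‖) :=
    (hu r (by simpa [abs_of_nonneg hr0] using hr2)).norm
  have hd : ∀ i : ℕ, DifferentiableOn ℂ (fun w : ℂ => u i * w ^ i) (Metric.ball 0 r) := by
    intro i
    fun_prop
  have hb : ∀ (i : ℕ) (w : ℂ), w ∈ Metric.ball (0 : ℂ) r →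
      ‖u i * w ^ i‖ ≤ ‖u i * (r : ℂ) ^ i‖ := by
    intro i w hw
    have hw' : ‖w‖ ≤ r := by simpa using (mem_ball_zero_iff.1 hw).le
    simp only [norm_mul, norm_pow, Complex.norm_real, Real.norm_eq_abs, abs_of_nonneg hr0]
    gcongr
  have hzm : z ∈ Metric.ball (0 : ℂ) r := mem_ball_zero_iff.2 hr1
  have h1 := Complex.hasSum_deriv_of_summable_norm hs hd Metric.isOpen_ball hb hzm
  have h2 := (Complex.differentiableOn_tsum_of_summable_norm hs hd Metric.isOpen_ball hb).differentiableAt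
    (Metric.isOpen_ball.mem_nhds hzm)
  rw [← hasSum_nat_add_iff' 1] at h1
  have h3 : HasSum (fun n : ℕ => (((n : ℂ) + 1) * u (n + 1)) * z ^ n)
      (deriv (fun w : ℂ => ∑' n, u n * w ^ n) z) := by
    convert! h1 using 1
    · ext n
      simp
      ring
    · simp
  refine ⟨h3.summable, ?_⟩
  rw [h3.tsum_eq]
  exact h2.hasDerivAt

theorem shift_hasSum (v : ℕ → ℂ) (z s : ℂ) (h : HasSum (fun n => v (n + 1) * z ^ n) s)
    (h0 : v 0 = 0) : HasSum (fun n => v n * z ^ n) (z * s) := by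
  rw [← hasSum_nat_add_iff' 1]
  convert! h.mul_left z using 1
  · ext n
    ring
  · simp [h0]

theorem hyp_ode (u : ℕ → ℂ) (a b c z F F1 F2 : ℂ)
    (hrec : ∀ n : ℕ, ((n : ℂ) + 1) * (n + c) * u (n + 1) = (n + a) * (n + b) * u n)
    (h0 : HasSum (fun n => u n * z ^ n) F)
    (h1 : HasSum (fun n : ℕ => (((n : ℂ) + 1) * u (n + 1)) * z ^ n) F1)
    (h2 : HasSum (fun n : ℕ => (((n : ℂ) + 1) *
      ((((n + 1 : ℕ) : ℂ) + 1) * u (n + 1 + 1))) * z ^ n) F2) :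
    z * (1 - z) * F2 + (c - (a + b + 1) * z) * F1 - a * b * F = 0 := by
  have k1 := shift_hasSum (fun n => (n : ℂ) * u n) z F1 (by simpa using h1) (by simp)
  have k2 := shift_hasSum (fun n => (n : ℂ) * (((n : ℂ) + 1) * u (n + 1))) z F2
    (by simpa using h2) (by simp)
  have k3 := shift_hasSum (fun n => (n : ℂ) * ((n : ℂ) - 1) * u n) z (z * F2) (by
    convert! k2 using 1
    ext n
    push_cast
    ring) (by simp)
  have key := (((k2.sub k3).add ((h1.mul_left c).sub (k1.mul_left (a + b + 1)))).sub
    (h0.mul_left (a * b)))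
  have hz : HasSum (fun _ : ℕ => (0 : ℂ)) 0 := hasSum_zero
  have := key.unique (by
    convert! hz using 1
    ext n
    linear_combination z ^ n * hrec n)
  linear_combination this

theorem hyp_radius (a b c : ℂ) (hc : ∀ n : ℕ, c ≠ -(n : ℂ)) :
    1 ≤ (ordinaryHypergeometricSeries ℂ a b c).radius := by
  by_cases ha : ∃ k : ℕ, a = -(k : ℂ)
  · obtain ⟨k, rfl⟩ := ha
    rw [ordinaryHypergeometric_radius_top_of_neg_nat₁]
    exact le_top
  by_cases hb : ∃ k : ℕ, b = -(k : ℂ)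
  · obtain ⟨k, rfl⟩ := hb
    rw [ordinaryHypergeometric_radius_top_of_neg_nat₂]
    exact le_top
  push Not at ha hb
  refine (ordinaryHypergeometricSeries_radius_eq_one ℂ a b c fun k => ⟨?_, ?_, ?_⟩).ge
  · intro h; exact ha k (by rw [h]; ring)
  · intro h; exact hb k (by rw [h]; ring)
  · intro h; exact hc k (by rw [h]; ring)

theorem hyp_main (a b c : ℂ) (hc : ∀ n : ℕ, c ≠ -(n : ℂ)) :
    ∃ F1 F2 : ℂ → ℂ, ∀ z : ℂ, ‖z‖ < 1 →
      HasDerivAt (ordinaryHypergeometric a b c) (F1 z) z ∧ HasDerivAt F1 (F2 z) z ∧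
      z * (1 - z) * F2 z + (c - (a + b + 1) * z) * F1 z
        - a * b * ordinaryHypergeometric a b c z = 0 := by
  set u : ℕ → ℂ := ordinaryHypergeometricCoefficient a b c with hu
  have hF : ordinaryHypergeometric a b c = fun z : ℂ => ∑' n, u n * z ^ n := by
    rw [ordinaryHypergeometric_eq_tsum]
    rfl
  have hs : ∀ z : ℂ, ‖z‖ < 1 → Summable (fun n => u n * z ^ n) := by
    intro z hz
    have := (ordinaryHypergeometricSeries ℂ a b c).summable (x := z) (by
      refine Metric.eball_subset_eball (hyp_radius a b c hc) ?_
      rw [Metric.mem_eball, edist_zero_right, ← ofReal_norm, ENNReal.ofReal_lt_one]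
      exact hz)
    rwa [ordinaryHypergeometricSeries_apply_eq'] at this
  have hrec : ∀ n : ℕ, ((n : ℂ) + 1) * (n + c) * u (n + 1) = (n + a) * (n + b) * u n := by
    intro n
    have h1 : (n : ℂ) + 1 ≠ 0 := by exact_mod_cast n.succ_ne_zero
    have h2 : c + n ≠ 0 := fun h => hc n (by linear_combination h)
    simp only [hu, ordinaryHypergeometricCoefficient, ascPochhammer_succ_eval, Nat.factorial_succ,
      mul_inv, Nat.cast_mul, Nat.cast_add, Nat.cast_one]
    generalize (Polynomial.eval c (ascPochhammer ℂ n))⁻¹ = p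
    generalize ((n.factorial : ℂ))⁻¹ = q
    field_simp
    ring
  have d1 := powser_deriv u hs
  have d2 := powser_deriv (fun n => ((n : ℂ) + 1) * u (n + 1)) (fun z hz => (d1 z hz).1)
  refine ⟨_, _, fun z hz => ⟨?_, (d2 z hz).2, ?_⟩⟩
  · rw [hF]
    exact (d1 z hz).2
  · rw [hF]
    exact hyp_ode u a b c z _ _ _ hrec (hs z hz).hasSum (d1 z hz).1.hasSum (d2 z hz).1.hasSum

theorem stmt12 (a b : ℂ) (hc : ∀ n : ℕ, a + b + 1/2 ≠ -(n : ℂ)) :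
    ∃ U : Set ℂ, IsOpen U ∧ (0 : ℂ) ∈ U ∧ ∀ x ∈ U, x ≠ (0 : ℂ) → x ≠ (1 : ℂ) → x ≠ (-3 : ℂ) →
      SatisfiesHeunAt (-3) (0) (3*a) (3*b) (2*a + 2*b) (1/2)
        (fun x : ℂ => ordinaryHypergeometric a b (a + b + 1/2) (x^2*(x+3)/4)) x := by
  obtain ⟨F1, F2, hF⟩ := hyp_main a b (a + b + 1/2) hc
  have hcont : Continuous (fun x : ℂ => ‖x^2*(x+3)/4‖) := by fun_prop
  have hopen : IsOpen {x : ℂ | ‖x^2*(x+3)/4‖ < 1} := isOpen_lt hcont continuous_const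
  refine ⟨_, hopen, by simp, ?_⟩
  intro x hx hx0 hx1 hx3
  have hp : ∀ y : ℂ, HasDerivAt (fun y : ℂ => y^2*(y+3)/4) (3*y*(y+2)/4) y := by
    intro y
    have := (((hasDerivAt_id y).pow 2).mul ((hasDerivAt_id y).add_const 3)).div_const 4
    convert! this using 1
    simp
    ring
  have hp2 : HasDerivAt (fun y : ℂ => 3*y*(y+2)/4) (3*(x+1)/2) x := by
    have := ((((hasDerivAt_id x).const_mul 3).mul ((hasDerivAt_id x).add_const 2))).div_const 4
    convert! this using 1
    simp
    ring
  have hg : ∀ y ∈ {x : ℂ | ‖x^2*(x+3)/4‖ < 1}, HasDerivAt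
      (fun x : ℂ => ordinaryHypergeometric a b (a + b + 1/2) (x^2*(x+3)/4))
      (F1 (y^2*(y+3)/4) * (3*y*(y+2)/4)) y := fun y hy => by
    have := (hF _ hy).1
    exact HasDerivAt.comp y this (hp y)
  have hg1 : HasDerivAt (fun y : ℂ => F1 (y^2*(y+3)/4) * (3*y*(y+2)/4))
      (F2 (x^2*(x+3)/4) * (3*x*(x+2)/4) * (3*x*(x+2)/4) + F1 (x^2*(x+3)/4) * (3*(x+1)/2)) x :=
    (HasDerivAt.comp x (hF _ hx).2.1 (hp x)).mul hp2
  have hg2 : HasDerivAt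
      (deriv (fun x : ℂ => ordinaryHypergeometric a b (a + b + 1/2) (x^2*(x+3)/4)))
      (F2 (x^2*(x+3)/4) * (3*x*(x+2)/4) * (3*x*(x+2)/4) + F1 (x^2*(x+3)/4) * (3*(x+1)/2)) x := by
    refine hg1.congr_of_eventuallyEq ?_
    filter_upwards [hopen.mem_nhds hx] with y hy
    exact (hg y hy).deriv
  refine ⟨(hg x hx).differentiableAt, hg2.differentiableAt, ?_⟩
  rw [hg2.deriv, (hg x hx).deriv]
  have ode := (hF _ hx).2.2
  -- at `x = -2` the argument equals `1`, which is excluded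
  have hx1' : x - 1 ≠ 0 := sub_ne_zero.2 hx1
  have hx3' : x + 3 ≠ 0 := fun h => hx3 (by linear_combination h)
  have hx2 : x + 2 ≠ 0 := by
    intro h
    have h' : x = -2 := by linear_combination h
    rw [h', Set.mem_setOf_eq] at hx
    norm_num at hx
  simp only [sub_neg_eq_add]
  beta_reduce
  generalize ordinaryHypergeometric a b (a + b + 1/2) (x^2*(x+3)/4) = G0 at ode ⊢
  generalize F1 (x^2*(x+3)/4) = G1 at ode ⊢
  generalize F2 (x^2*(x+3)/4) = G2 at ode ⊢
  linear_combination (exp := 1) (-9 / ((x+3)*(x-1))) * ode + (by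
    field_simp
    ring : (G2 * (3*x*(x+2)/4) * (3*x*(x+2)/4) + G1 * (3*(x+1)/2) +
      ((2*a+2*b) / x + 1/2 / (x - 1) + (3*a + 3*b - (2*a+2*b) - 1/2 + 1) / (x + 3)) *
        (G1 * (3*x*(x+2)/4)) + ((3*a * (3*b) * x - 0) / (x * (x - 1) * (x + 3))) * G0 =
      (-9 / ((x+3)*(x-1))) * (x^2*(x+3)/4 * (1 - x^2*(x+3)/4) * G2 +
        (a + b + 1/2 - (a + b + 1) * (x^2*(x+3)/4)) * G1 - a * b * G0)))
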